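/- Let Ψ be a countable collection of measurable functions on Y containing at least one constant function, with α ≤ ψ ≤ β for all ψ ∈ Ψ. Let 0 ≤ a < 1 < b ≤ ∞ and f ∈ F₁(a,b) be strictly convex in a neighborhood of 1 with z₀ + β − α in the interior of {f* < ∞}, where z₀ := f'_+(1). Assume also that (f*)'_+ is L_{α,β}-Lipschitz on [z₀−(β−α), z₀+β−α]. Let P be a probability measure on Y, Y₁,…,Y_n i.i.d. samples from P, and P_n the corresponding empirical measure. Then, for either choice of sign, E[ sup_{ψ∈Ψ} { ±( Λ_f^P[ψ] − Λ_f^{P_n}[ψ] ) } ] ≤ 2 · min{ (1 + 2(β−α) L_{α,β}) R_{Ψ,P,n} + (β−α)² L_{α,β} / (2 n^{1/2}), (f*)'_+(β−α+z₀) ( R_{Ψ,P,n} + (β−α)/(2 n^{1/2}) ) }. -/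

import Mathlib

open MeasureTheory Set Filter Topology
open scoped ENNReal NNReal Classical

noncomputable section

/-- The interval `(a, b)` with `b` possibly infinite. -/
def Dom (a : ℝ) (b : EReal) : Set ℝ := {t : ℝ | a < t ∧ (t : EReal) < b}

/-- Legendre transform of `f` on `(a,b)`, with values in `(-∞, ∞]` (modeled by `EReal`). -/
def fStar (f : ℝ → ℝ) (a : ℝ) (b : EReal) (z : ℝ) : EReal :=
  ⨆ t ∈ Dom a b, ((z * t - f t : ℝ) : EReal)

/-- Real-valued version of the Legendre transform (junk value where it is `⊤`). -/
def fStarR (f : ℝ → ℝ) (a : ℝ) (b : EReal) (z : ℝ) : ℝ := (fStar f a b z).toReal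

/-- Right derivative of `g` at `z`. -/
def rderiv (g : ℝ → ℝ) (z : ℝ) : ℝ := derivWithin g (Ici z) z

/-- `z₀ := f'_+(1)`. -/
def zz (f : ℝ → ℝ) : ℝ := rderiv f 1

/-- Integral of an `EReal`-valued function: the Bochner integral if the function is
a.e. finite and integrable, and `⊤` otherwise. -/
def eIntegral {X : Type*} [MeasurableSpace X] (P : Measure X) (g : X → EReal) : EReal :=
  if (∀ᵐ x ∂P, g x ≠ ⊤) ∧ Integrable (fun x => (g x).toReal) P
  then ((∫ x, (g x).toReal ∂P : ℝ) : EReal) else ⊤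

/-- The generalized cumulant generating function `Λ_f^P[h]`. -/
def cgf {X : Type*} [MeasurableSpace X] (f : ℝ → ℝ) (a : ℝ) (b : EReal)
    (P : Measure X) (h : X → ℝ) : EReal :=
  ⨅ ν : ℝ, ((ν : EReal) + eIntegral P (fun x => fStar f a b (h x - ν)))

/-- Real-valued `Λ_f^P[h]`. -/
def cgfR {X : Type*} [MeasurableSpace X] (f : ℝ → ℝ) (a : ℝ) (b : EReal)
    (P : Measure X) (h : X → ℝ) : ℝ := (cgf f a b P h).toReal

/-- `Λ_f : ℝⁿ → ℝ` (with values in `EReal`). -/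
def lamVec (f : ℝ → ℝ) (a : ℝ) (b : EReal) {n : ℕ} (x : Fin n → ℝ) : EReal :=
  ⨅ ν : ℝ, ((ν : EReal) + ((n : ℝ)⁻¹ : EReal) * ∑ i, fStar f a b (x i - ν))

/-- Empirical measure of `n` points. -/
def empMeas {X : Type*} [MeasurableSpace X] (n : ℕ) (xs : Fin n → X) : Measure X :=
  (n : ℝ≥0∞)⁻¹ • ∑ i, Measure.dirac (xs i)

/-- The `(f,Γ)`-divergence `D_f^Γ(Q‖P)`. -/
def Dfg {X : Type*} [MeasurableSpace X] (f : ℝ → ℝ) (a : ℝ) (b : EReal)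
    (Γ : Set (X → ℝ)) (Q P : Measure X) : ℝ :=
  sSup {r : ℝ | ∃ h ∈ Γ, r = ∫ x, h x ∂Q - cgfR f a b P h}

/-- Empirical Rademacher complexity of `Ψ` at the sample `y`. -/
def empRad {Y : Type*} (Ψ : Set (Y → ℝ)) (n : ℕ) (y : Fin n → Y) : ℝ :=
  (2 ^ n : ℝ)⁻¹ * ∑ σ : Fin n → Bool,
    sSup {r : ℝ | ∃ ψ ∈ Ψ, r = (n : ℝ)⁻¹ * ∑ i, (if σ i then 1 else -1) * ψ (y i)}

/-- Rademacher complexity of `Ψ` relative to `P` with `n` samples. -/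
def rad {Y : Type*} [MeasurableSpace Y] (Ψ : Set (Y → ℝ)) (P : Measure Y) (n : ℕ) : ℝ :=
  ∫ y, empRad Ψ n y ∂(Measure.pi fun _ : Fin n => P)

/-- `Δ_{f,n}`. -/
def Δq (f : ℝ → ℝ) (a : ℝ) (b : EReal) (α β : ℝ) (n : ℕ) : ℝ :=
  sInf ((fun z => (n : ℝ) * (-z + (((n : ℝ) - 1) / (n : ℝ)) * fStarR f a b z
      + (1 / (n : ℝ)) * fStarR f a b (β - α + z))) '' Icc (zz f - (β - α)) (zz f))

/-- `sup_{h ∈ Γ} inf_{h̃ ∈ Γ̃} ‖h − h̃‖_∞`. -/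
def approxErr {X : Type*} (Γ Γt : Set (X → ℝ)) : ℝ :=
  sSup {r : ℝ | ∃ h ∈ Γ, r = sInf {s : ℝ | ∃ ht ∈ Γt, s = ⨆ x, |h x - ht x|}}

/-- A countable subset which is pointwise-limit dense. -/
def PtwiseDenseCount {X : Type*} (Γ : Set (X → ℝ)) : Prop :=
  ∃ Γ₀ ⊆ Γ, Γ₀.Countable ∧ ∀ h ∈ Γ, ∃ s : ℕ → X → ℝ,
    (∀ j, s j ∈ Γ₀) ∧ ∀ x, Tendsto (fun j => s j x) atTop (𝓝 (h x))

/-- The quantity `K_{f,Ψ,P,n}` from Definition 3.4: either `(f*)'_+` is Lipschitz on the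
relevant interval and `Ψ` contains a constant, in which case `K` is the minimum of the two
expressions, or `K` is the second expression. -/
def Kchoice (f : ℝ → ℝ) (a : ℝ) (b : EReal) (α β : ℝ) {Y : Type*} [MeasurableSpace Y]
    (Ψ : Set (Y → ℝ)) (P : Measure Y) (n : ℕ) (K : ℝ) : Prop :=
  (∃ L : ℝ≥0, LipschitzOnWith L (rderiv (fStarR f a b))
      (Icc (zz f - (β - α)) (zz f + (β - α))) ∧
    (∃ c : ℝ, (fun _ => c) ∈ Ψ) ∧
    K = min ((1 + 2 * (β - α) * (L : ℝ)) * rad Ψ P n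
        + (β - α) ^ 2 * (L : ℝ) / (2 * Real.sqrt n))
      (rderiv (fStarR f a b) (β - α + zz f) * (rad Ψ P n + (β - α) / (2 * Real.sqrt n))))
  ∨ K = rderiv (fStarR f a b) (β - α + zz f) * (rad Ψ P n + (β - α) / (2 * Real.sqrt n))

/-- Covering number of a (pseudo)metric space by `ε`-balls. -/
def coverNum (Θ : Type*) [PseudoMetricSpace Θ] (ε : ℝ) : ℝ≥0∞ :=
  ⨅ s ∈ {s : Finset Θ | ∀ θ : Θ, ∃ c ∈ s, dist θ c ≤ ε}, ((s.card : ℝ≥0∞))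

end

/-- The sign `±1` attached to a Boolean. -/
def boolSign (b : Bool) : ℝ := if b then 1 else -1

lemma abs_boolSign (b : Bool) : |boolSign b| = 1 := by
  cases b <;> simp [boolSign]

lemma abs_sum_boolSign_mul_le {n : ℕ} (σ : Fin n → Bool) {v : Fin n → ℝ} {C : ℝ}
    (hv : ∀ j, |v j| ≤ C) : |∑ j, boolSign (σ j) * v j| ≤ n * C := by
  calc |∑ j, boolSign (σ j) * v j| ≤ ∑ j, |boolSign (σ j) * v j| :=
        Finset.abs_sum_le_sum_abs _ _
    _ ≤ ∑ _j : Fin n, C := Finset.sum_le_sum fun j _ => by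
        rw [abs_mul, abs_boolSign, one_mul]; exact hv j
    _ = n * C := by simp

lemma sum_bool_cons {n : ℕ} (F : (Fin (n + 1) → Bool) → ℝ) :
    ∑ σ, F σ = ∑ σ : Fin n → Bool, F (Fin.cons true σ) +
      ∑ σ : Fin n → Bool, F (Fin.cons false σ) := by
  rw [← (Fin.consEquiv fun _ => Bool).sum_comp, Fintype.sum_prod_type, Fintype.sum_bool]
  rfl

lemma sum_sq_sum_boolSign (n : ℕ) :
    ∑ σ : Fin n → Bool, (∑ j, boolSign (σ j)) ^ 2 = 2 ^ n * n := by
  induction n with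
  | zero => simp
  | succ n ih =>
    rw [sum_bool_cons, ← Finset.sum_add_distrib]
    have h : ∀ σ : Fin n → Bool,
        (∑ j, boolSign ((Fin.cons true σ : Fin (n + 1) → Bool) j)) ^ 2 +
          (∑ j, boolSign ((Fin.cons false σ : Fin (n + 1) → Bool) j)) ^ 2 =
        2 * (∑ j, boolSign (σ j)) ^ 2 + 2 := fun σ => by
      simp only [Fin.sum_univ_succ, Fin.cons_zero, Fin.cons_succ, boolSign]
      simp only [if_true, Bool.false_eq_true, if_false]
      ring
    rw [Finset.sum_congr rfl fun σ _ => h σ, Finset.sum_add_distrib, ← Finset.mul_sum, ih]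
    simp
    ring

lemma sum_sum_boolSign (n : ℕ) : ∑ σ : Fin n → Bool, ∑ j, boolSign (σ j) = 0 := by
  induction n with
  | zero => simp
  | succ n ih =>
    rw [sum_bool_cons, ← Finset.sum_add_distrib]
    simp [Fin.sum_univ_succ, boolSign, Finset.sum_add_distrib] at ih ⊢
    linarith

lemma sum_abs_sum_boolSign_le (n : ℕ) :
    ∑ σ : Fin n → Bool, |∑ j, boolSign (σ j)| ≤ 2 ^ n * Real.sqrt n := by
  have h := sq_sum_le_card_mul_sum_sq (s := (Finset.univ : Finset (Fin n → Bool)))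
    (f := fun σ => |∑ j, boolSign (σ j)|)
  simp only [sq_abs, sum_sq_sum_boolSign] at h
  have hc : ((Finset.univ : Finset (Fin n → Bool)).card : ℝ) = 2 ^ n := by simp
  rw [hc] at h
  refine abs_le_of_sq_le_sq' ?_ (by positivity) |>.2
  rw [mul_pow, Real.sq_sqrt (Nat.cast_nonneg n)]
  linarith

/-- Contraction for a single Rademacher variable. -/
lemma ciSup_add_ciSup_sub_le {ι : Type*} [Nonempty ι] {d v u : ι → ℝ}
    (h : ∀ i k, |v i - v k| ≤ |u i - u k|)
    (hp : BddAbove (range fun i => d i + u i)) (hm : BddAbove (range fun i => d i - u i)) :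
    (⨆ i, (d i + v i)) + (⨆ i, (d i - v i)) ≤ (⨆ i, (d i + u i)) + ⨆ i, (d i - u i) := by
  refine ciSup_add_ciSup_le fun i k => ?_
  have h1 := le_ciSup hp i
  have h2 := le_ciSup hp k
  have h3 := le_ciSup hm i
  have h4 := le_ciSup hm k
  have h5 := le_trans (le_abs_self _) (h i k)
  rcases abs_cases (u i - u k) with ⟨h6, _⟩ | ⟨h6, _⟩ <;> linarith

lemma bddAbove_range_of_abs_le {ι : Type*} {g : ι → ℝ} {C : ℝ} (h : ∀ i, |g i| ≤ C) :
    BddAbove (range g) := by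
  refine ⟨C, ?_⟩
  rintro _ ⟨i, rfl⟩
  exact (abs_le.1 (h i)).2

/-- The Ledoux-Talagrand contraction principle, with an arbitrary offset. -/
lemma sum_ciSup_contraction {ι : Type*} [Nonempty ι] {n : ℕ} {C : ℝ} (c : ι → ℝ)
    (v u : ι → Fin n → ℝ) {K : ℝ} (hc : ∀ i, |c i| ≤ K) (hv : ∀ i j, |v i j| ≤ C)
    (hu : ∀ i j, |u i j| ≤ C) (h : ∀ i k j, |v i j - v k j| ≤ |u i j - u k j|) :
    ∑ σ : Fin n → Bool, ⨆ i, (c i + ∑ j, boolSign (σ j) * v i j) ≤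
      ∑ σ : Fin n → Bool, ⨆ i, (c i + ∑ j, boolSign (σ j) * u i j) := by
  induction n generalizing c K with
  | zero => simp
  | succ n ih =>
    have key : ∀ w : ι → Fin (n + 1) → ℝ, ∀ b : Bool, ∀ σ : Fin n → Bool,
        (⨆ i, (c i + ∑ j, boolSign ((Fin.cons b σ : Fin (n + 1) → Bool) j) * w i j)) =
        ⨆ i, ((c i + boolSign b * w i 0) + ∑ j, boolSign (σ j) * w i j.succ) := by
      intro w b σ
      refine iSup_congr fun i => ?_
      rw [Fin.sum_univ_succ]
      simp only [Fin.cons_zero, Fin.cons_succ, add_assoc]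
    simp only [sum_bool_cons, key]
    have step : ∀ b : Bool,
        ∑ σ : Fin n → Bool,
          (⨆ i, ((c i + boolSign b * v i 0) + ∑ j, boolSign (σ j) * v i j.succ)) ≤
        ∑ σ : Fin n → Bool,
          ⨆ i, ((c i + boolSign b * v i 0) + ∑ j, boolSign (σ j) * u i j.succ) := fun b =>
      ih (fun i => c i + boolSign b * v i 0) (fun i j => v i j.succ) (fun i j => u i j.succ)
        (K := K + C) (fun i => (abs_add_le _ _).trans (add_le_add (hc i) (by
          rw [abs_mul, abs_boolSign, one_mul]; exact hv i 0)))
        (fun i j => hv i _) (fun i j => hu i _) (fun i k j => h i k _)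
    refine (add_le_add (step true) (step false)).trans ?_
    rw [← Finset.sum_add_distrib, ← Finset.sum_add_distrib]
    refine Finset.sum_le_sum fun σ _ => ?_
    have hd : ∀ i, |c i + ∑ j, boolSign (σ j) * u i j.succ| ≤ K + n * C := fun i =>
      (abs_add_le _ _).trans (add_le_add (hc i) (abs_sum_boolSign_mul_le σ fun j => hu i _))
    have := ciSup_add_ciSup_sub_le (d := fun i => c i + ∑ j, boolSign (σ j) * u i j.succ)
      (v := fun i => v i 0) (u := fun i => u i 0) (fun i k => h i k 0)
      (bddAbove_range_of_abs_le fun i => (abs_add_le _ _).trans (add_le_add (hd i) (hu i 0)))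
      (bddAbove_range_of_abs_le fun i => (abs_sub _ _).trans (add_le_add (hd i) (hu i 0)))
    have e1 : ∀ w : ι → Fin (n + 1) → ℝ, ∀ i,
        c i + boolSign true * w i 0 + ∑ j, boolSign (σ j) * u i j.succ =
        (c i + ∑ j, boolSign (σ j) * u i j.succ) + w i 0 := fun w i => by
      simp [boolSign]; ring
    have e2 : ∀ w : ι → Fin (n + 1) → ℝ, ∀ i,
        c i + boolSign false * w i 0 + ∑ j, boolSign (σ j) * u i j.succ =
        (c i + ∑ j, boolSign (σ j) * u i j.succ) - w i 0 := fun w i => by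
      simp [boolSign]; ring
    simp only [e1, e2]
    exact this

section Legendre

variable {f : ℝ → ℝ} {a : ℝ} {b : EReal} {x y z t D : ℝ}

lemma coe_le_fStar (ht : t ∈ Dom a b) : ((z * t - f t : ℝ) : EReal) ≤ fStar f a b z :=
  le_iSup₂ (f := fun t (_ : t ∈ Dom a b) => ((z * t - f t : ℝ) : EReal)) t ht

lemma fStar_le_coe {B : ℝ} (h : ∀ t ∈ Dom a b, z * t - f t ≤ B) : fStar f a b z ≤ B :=
  iSup₂_le fun t ht => EReal.coe_le_coe_iff.2 (h t ht)

lemma monotone_fStar (ha : 0 ≤ a) : Monotone (fStar f a b) := fun x y hxy =>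
  iSup₂_le fun t ht => le_trans (EReal.coe_le_coe_iff.2 (by
    have := mul_le_mul_of_nonneg_right hxy (ha.trans ht.1.le)
    linarith)) (coe_le_fStar ht)

lemma fStar_ne_bot (h1 : (1 : ℝ) ∈ Dom a b) : fStar f a b z ≠ ⊥ := fun h => by
  have := coe_le_fStar (f := f) (z := z) h1
  rw [h, le_bot_iff] at this
  exact EReal.coe_ne_bot _ this

lemma coe_fStarR (h1 : (1 : ℝ) ∈ Dom a b) (hz : fStar f a b z < ⊤) :
    (fStarR f a b z : EReal) = fStar f a b z :=
  EReal.coe_toReal hz.ne (fStar_ne_bot h1)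

lemma le_fStarR (h1 : (1 : ℝ) ∈ Dom a b) (hz : fStar f a b z < ⊤) (ht : t ∈ Dom a b) :
    z * t - f t ≤ fStarR f a b z := by
  rw [← EReal.coe_le_coe_iff, coe_fStarR h1 hz]
  exact coe_le_fStar ht

lemma fStar_lt_top_of_forall_le {B : ℝ} (h : ∀ t ∈ Dom a b, z * t - f t ≤ B) :
    fStar f a b z < ⊤ :=
  (fStar_le_coe h).trans_lt (EReal.coe_lt_top B)

lemma fStarR_le (h1 : (1 : ℝ) ∈ Dom a b) {B : ℝ} (h : ∀ t ∈ Dom a b, z * t - f t ≤ B) :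
    fStarR f a b z ≤ B := by
  rw [← EReal.coe_le_coe_iff, coe_fStarR h1 (fStar_lt_top_of_forall_le h)]
  exact fStar_le_coe h

lemma self_le_fStarR (h1 : (1 : ℝ) ∈ Dom a b) (hf1 : f 1 = 0) (hz : fStar f a b z < ⊤) :
    z ≤ fStarR f a b z := by
  simpa [hf1] using le_fStarR h1 hz h1

lemma fStarR_le_fStarR (ha : 0 ≤ a) (h1 : (1 : ℝ) ∈ Dom a b) (hxy : x ≤ y)
    (hy : fStar f a b y < ⊤) : fStarR f a b x ≤ fStarR f a b y := by
  rw [← EReal.coe_le_coe_iff, coe_fStarR h1 hy,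
    coe_fStarR h1 ((monotone_fStar ha hxy).trans_lt hy)]
  exact monotone_fStar ha hxy

lemma convexOn_fStarR (h1 : (1 : ℝ) ∈ Dom a b) :
    ConvexOn ℝ {z | fStar f a b z < ⊤} (fStarR f a b) := by
  have key : ∀ x, fStar f a b x < ⊤ → ∀ y, fStar f a b y < ⊤ → ∀ p q : ℝ, 0 ≤ p → 0 ≤ q →
      p + q = 1 → ∀ t ∈ Dom a b,
      (p • x + q • y) * t - f t ≤ p • fStarR f a b x + q • fStarR f a b y := by
    intro x hx y hy p q hp hq hpq t ht
    have hx' := mul_le_mul_of_nonneg_left (le_fStarR h1 hx ht) hp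
    have hy' := mul_le_mul_of_nonneg_left (le_fStarR h1 hy ht) hq
    have hf : f t = p * f t + q * f t := by rw [← add_mul, hpq, one_mul]
    simp only [smul_eq_mul]
    rw [hf]
    linarith
  refine ⟨fun x hx y hy p q hp hq hpq => ?_, fun x hx y hy p q hp hq hpq => ?_⟩
  · exact fStar_lt_top_of_forall_le (key x hx y hy p q hp hq hpq)
  · exact fStarR_le h1 (key x hx y hy p q hp hq hpq)

lemma isOpen_Dom : IsOpen (Dom a b) :=
  isOpen_Ioi.inter (isOpen_Iio.preimage continuous_coe_real_ereal)

lemma ConvexOn.rderiv_mul_le {g : ℝ → ℝ} {S : Set ℝ} (hg : ConvexOn ℝ S g)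
    (hx : x ∈ interior S) (hy : y ∈ S) (hxy : x ≤ y) : rderiv g x * (y - x) ≤ g y - g x := by
  rcases hxy.eq_or_lt with rfl | hxy
  · simp
  have := hg.rightDeriv_le_slope_of_mem_interior hx hy hxy
  rwa [derivWithin_Ioi_eq_Ici, slope_def_field, le_div_iff₀ (sub_pos.2 hxy)] at this

lemma ConvexOn.sub_le_rderiv_mul {g : ℝ → ℝ} {S : Set ℝ} (hg : ConvexOn ℝ S g)
    (hx : x ∈ S) (hy : y ∈ interior S) (hxy : x ≤ y) : g y - g x ≤ rderiv g y * (y - x) := by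
  rcases hxy.eq_or_lt with rfl | hxy
  · simp
  have := (hg.slope_le_leftDeriv_of_mem_interior hx hy hxy).trans
    (hg.leftDeriv_le_rightDeriv_of_mem_interior hy)
  rwa [derivWithin_Ioi_eq_Ici, slope_def_field, div_le_iff₀ (sub_pos.2 hxy)] at this

lemma ConvexOn.rderiv_mono {g : ℝ → ℝ} {S : Set ℝ} (hg : ConvexOn ℝ S g)
    (hx : x ∈ interior S) (hy : y ∈ interior S) (hxy : x ≤ y) : rderiv g x ≤ rderiv g y := by
  have := hg.monotoneOn_rightDeriv hx hy hxy
  simpa only [derivWithin_Ioi_eq_Ici, rderiv] using this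

lemma zz_mul_le (h1 : (1 : ℝ) ∈ Dom a b) (hconv : ConvexOn ℝ (Dom a b) f) (hf1 : f 1 = 0)
    (ht : t ∈ Dom a b) : zz f * (t - 1) ≤ f t := by
  have hi : (1 : ℝ) ∈ interior (Dom a b) := by rwa [isOpen_Dom.interior_eq]
  rcases le_total 1 t with h | h
  · simpa [hf1, zz] using hconv.rderiv_mul_le hi ht h
  · have := hconv.sub_le_rderiv_mul ht hi h
    rw [hf1] at this
    simp only [zz]
    linarith

lemma fStar_zz_lt_top (h1 : (1 : ℝ) ∈ Dom a b) (hconv : ConvexOn ℝ (Dom a b) f)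
    (hf1 : f 1 = 0) : fStar f a b (zz f) < ⊤ :=
  fStar_lt_top_of_forall_le (B := zz f) fun t ht => by
    linarith [zz_mul_le h1 hconv hf1 ht]

lemma fStarR_zz (h1 : (1 : ℝ) ∈ Dom a b) (hconv : ConvexOn ℝ (Dom a b) f) (hf1 : f 1 = 0) :
    fStarR f a b (zz f) = zz f :=
  le_antisymm (fStarR_le h1 fun t ht => by linarith [zz_mul_le h1 hconv hf1 ht])
    (self_le_fStarR h1 hf1 (fStar_zz_lt_top h1 hconv hf1))

lemma convexOn_fStarR_sub (h1 : (1 : ℝ) ∈ Dom a b) :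
    ConvexOn ℝ {z | fStar f a b z < ⊤} (fun z => fStarR f a b z - z) :=
  (convexOn_fStarR h1).sub (concaveOn_id (convexOn_fStarR h1).1)

lemma fStarR_add_le (h1 : (1 : ℝ) ∈ Dom a b) (hconv : ConvexOn ℝ (Dom a b) f) (hf1 : f 1 = 0)
    (hx : zz f ≤ x) (hxy : x ≤ y) (hy : fStar f a b y < ⊤) :
    fStarR f a b x + (y - x) ≤ fStarR f a b y := by
  have := (convexOn_fStarR_sub (f := f) h1).le_max_of_mem_Icc (fStar_zz_lt_top h1 hconv hf1) hy
    ⟨hx, hxy⟩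
  rw [fStarR_zz h1 hconv hf1, sub_self, max_eq_right
    (sub_nonneg.2 (self_le_fStarR h1 hf1 hy))] at this
  linarith

lemma fStarR_sub_le (ha : 0 ≤ a) (h1 : (1 : ℝ) ∈ Dom a b) (hconv : ConvexOn ℝ (Dom a b) f)
    (hf1 : f 1 = 0) (hxy : x ≤ y) (hy : y ≤ zz f) :
    fStarR f a b y - (y - x) ≤ fStarR f a b x := by
  have hz := fStar_zz_lt_top h1 hconv hf1
  have hx : fStar f a b x < ⊤ := (monotone_fStar ha (hxy.trans hy)).trans_lt hz
  have := (convexOn_fStarR_sub (f := f) h1).le_max_of_mem_Icc hx hz ⟨hxy, hy⟩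
  rw [fStarR_zz h1 hconv hf1, sub_self, max_eq_left
    (sub_nonneg.2 (self_le_fStarR h1 hf1 hx))] at this
  linarith

lemma mem_interior_of_le (ha : 0 ≤ a) (hy : y ∈ interior {z | fStar f a b z < ⊤})
    (hxy : x ≤ y) : x ∈ interior {z | fStar f a b z < ⊤} := by
  rw [mem_interior_iff_mem_nhds, Metric.mem_nhds_iff] at hy ⊢
  obtain ⟨ε, hε, h⟩ := hy
  refine ⟨ε, hε, fun z hz => ?_⟩
  have : z + (y - x) ∈ Metric.ball y ε := by
    rw [Metric.mem_ball, Real.dist_eq] at hz ⊢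
    convert hz using 2
    ring
  exact (monotone_fStar ha (by linarith)).trans_lt (h this)

lemma lt_top_of_mem_interior (hx : x ∈ interior {z | fStar f a b z < ⊤}) :
    fStar f a b x < ⊤ :=
  interior_subset (s := {z | fStar f a b z < ⊤}) hx

lemma one_le_rderiv_zz (h1 : (1 : ℝ) ∈ Dom a b) (hconv : ConvexOn ℝ (Dom a b) f)
    (hf1 : f 1 = 0) (hz : zz f ∈ interior {z | fStar f a b z < ⊤}) :
    1 ≤ rderiv (fStarR f a b) (zz f) := by
  obtain ⟨ε, hε, h⟩ := Metric.mem_nhds_iff.1 (mem_interior_iff_mem_nhds.1 hz)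
  have hd := (convexOn_fStarR (f := f) h1).differentiableWithinAt_Ioi_of_mem_interior hz
  have hd' : HasDerivWithinAt (fStarR f a b) (rderiv (fStarR f a b) (zz f)) (Ioi (zz f))
      (zz f) := by
    rw [rderiv, ← derivWithin_Ioi_eq_Ici]
    exact hd.hasDerivWithinAt
  refine ge_of_tendsto ((hasDerivWithinAt_iff_tendsto_slope' self_notMem_Ioi).1 hd') ?_
  filter_upwards [Ioo_mem_nhdsGT (show zz f < zz f + ε / 2 by linarith)] with y hy
  have hyS : fStar f a b y < ⊤ := h (by
    rw [Metric.mem_ball, Real.dist_eq, abs_of_pos (by linarith [hy.1])]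
    linarith [hy.2])
  rw [slope_def_field, le_div_iff₀ (by linarith [hy.1]), fStarR_zz h1 hconv hf1]
  linarith [self_le_fStarR h1 hf1 hyS]

lemma rderiv_zz_le_one (ha : 0 ≤ a) (h1 : (1 : ℝ) ∈ Dom a b) (hconv : ConvexOn ℝ (Dom a b) f)
    (hf1 : f 1 = 0) (hz : zz f ∈ interior {z | fStar f a b z < ⊤}) (hD : 0 < D) {L : ℝ≥0}
    (hLip : LipschitzOnWith L (rderiv (fStarR f a b)) (Icc (zz f - D) (zz f + D))) :
    rderiv (fStarR f a b) (zz f) ≤ 1 := by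
  have hx : ∀ x < zz f, rderiv (fStarR f a b) x ≤ 1 := fun x hx => by
    have hxi := mem_interior_of_le ha hz hx.le
    have := (convexOn_fStarR (f := f) h1).rderiv_mul_le hxi (interior_subset hz) hx.le
    rw [fStarR_zz h1 hconv hf1] at this
    have h2 := self_le_fStarR h1 hf1 (lt_top_of_mem_interior hxi)
    by_contra! h3
    nlinarith
  refine le_of_forall_pos_le_add fun ε hε => ?_
  set δ := min D (ε / (L + 1)) with hδ
  have hL : (0 : ℝ) < L + 1 := by positivity
  have hδ0 : 0 < δ := lt_min hD (by positivity)
  have hδD : δ ≤ D := min_le_left _ _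
  have hδε : δ * (L + 1) ≤ ε := by
    rw [← le_div_iff₀ hL]
    exact min_le_right _ _
  have := hLip.dist_le_mul (zz f) ⟨by linarith, by linarith⟩ (zz f - δ)
    ⟨by linarith, by linarith⟩
  rw [Real.dist_eq, Real.dist_eq, sub_sub_cancel, abs_of_pos hδ0] at this
  have h2 := (abs_le.1 this).2
  have h3 := hx (zz f - δ) (by linarith)
  nlinarith

lemma rderiv_fStarR_nonneg (ha : 0 ≤ a) (h1 : (1 : ℝ) ∈ Dom a b)
    (hy : y ∈ interior {z | fStar f a b z < ⊤}) : 0 ≤ rderiv (fStarR f a b) y := by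
  have hx := mem_interior_of_le (x := y - 1) ha hy (by linarith)
  have := (convexOn_fStarR (f := f) h1).sub_le_rderiv_mul (interior_subset hx) hy (by linarith)
  have h2 := fStarR_le_fStarR (f := f) (x := y - 1) ha h1 (by linarith) (lt_top_of_mem_interior hy)
  linarith

lemma abs_fStarR_sub_le (ha : 0 ≤ a) (h1 : (1 : ℝ) ∈ Dom a b)
    (hz : z ∈ interior {z | fStar f a b z < ⊤}) (hx : x ≤ z) (hy : y ≤ z) :
    |fStarR f a b x - fStarR f a b y| ≤ rderiv (fStarR f a b) z * |x - y| := by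
  wlog hxy : x ≤ y generalizing x y
  · rw [abs_sub_comm, abs_sub_comm x]
    exact this hy hx (le_of_not_ge hxy)
  have hyi := mem_interior_of_le ha hz hy
  have hxi := mem_interior_of_le ha hz hx
  have hc := convexOn_fStarR (f := f) h1
  rw [abs_of_nonpos (by linarith [fStarR_le_fStarR ha h1 hxy (lt_top_of_mem_interior hyi)]),
    abs_of_nonpos (by linarith), neg_sub, neg_sub]
  exact (hc.sub_le_rderiv_mul (interior_subset hxi) hyi hxy).trans
    (mul_le_mul_of_nonneg_right (hc.rderiv_mono hyi hz hy) (by linarith))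

lemma abs_fStarR_sub_self_sub_le (ha : 0 ≤ a) (h1 : (1 : ℝ) ∈ Dom a b)
    (hconv : ConvexOn ℝ (Dom a b) f) (hf1 : f 1 = 0) (hD : 0 ≤ D)
    (hz : zz f + D ∈ interior {z | fStar f a b z < ⊤}) {L : ℝ≥0}
    (hLip : LipschitzOnWith L (rderiv (fStarR f a b)) (Icc (zz f - D) (zz f + D)))
    (hx : x ∈ Icc (zz f - D) (zz f + D)) (hy : y ∈ Icc (zz f - D) (zz f + D)) :
    |(fStarR f a b x - x) - (fStarR f a b y - y)| ≤ D * L * |x - y| := by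
  rcases hD.eq_or_lt with rfl | hD
  · have : x = y := by linarith [hx.1, hx.2, hy.1, hy.2]
    simp [this]
  wlog hxy : x ≤ y generalizing x y
  · rw [abs_sub_comm, abs_sub_comm x]
    exact this hy hx (le_of_not_ge hxy)
  have hzi := mem_interior_of_le (x := zz f) ha hz (by linarith)
  have hyi := mem_interior_of_le ha hz hy.2
  have hxi := mem_interior_of_le ha hz hx.2
  have hc := convexOn_fStarR (f := f) h1
  have e1 := one_le_rderiv_zz h1 hconv hf1 hzi
  have e2 := rderiv_zz_le_one ha h1 hconv hf1 hzi hD hLip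
  have bound : ∀ w ∈ Icc (zz f - D) (zz f + D), |rderiv (fStarR f a b) w - 1| ≤ D * L := by
    intro w hw
    have := hLip.dist_le_mul w hw (zz f) ⟨by linarith, by linarith⟩
    rw [Real.dist_eq, Real.dist_eq, le_antisymm e2 e1] at this
    refine this.trans ?_
    rw [mul_comm]
    exact mul_le_mul_of_nonneg_right (abs_le.2 ⟨by linarith [hw.1], by linarith [hw.2]⟩) L.2
  have l1 := hc.rderiv_mul_le hxi (interior_subset hyi) hxy
  have l2 := hc.sub_le_rderiv_mul (interior_subset hxi) hyi hxy
  have b1 := mul_le_mul_of_nonneg_right (abs_le.1 (bound x hx)).1 (sub_nonneg.2 hxy)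
  have b2 := mul_le_mul_of_nonneg_right (abs_le.1 (bound y hy)).2 (sub_nonneg.2 hxy)
  rw [abs_sub_comm x y, abs_of_nonneg (sub_nonneg.2 hxy), abs_le]
  constructor <;> linarith

end Legendre

section CumulantGenerating

variable {f : ℝ → ℝ} {a : ℝ} {b : EReal} {Y : Type*} [MeasurableSpace Y] {h : Y → ℝ}
  {α β ν B : ℝ} (Q : Measure Y) [IsProbabilityMeasure Q]

lemma measurable_fStarR (ha : 0 ≤ a) : Measurable (fStarR f a b) :=
  (monotone_fStar ha).measurable.ereal_toReal

lemma sub_mem_Icc {z₀ v : ℝ} (hv : v ∈ Icc α β) (hν : ν ∈ Icc (α - z₀) (β - z₀)) :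
    v - ν ∈ Icc (z₀ - (β - α)) (z₀ + (β - α)) :=
  ⟨by linarith [hv.1, hν.2], by linarith [hv.2, hν.1]⟩

lemma integrable_fStarR_sub (ha : 0 ≤ a) (h1 : (1 : ℝ) ∈ Dom a b)
    (hz : zz f + (β - α) ∈ interior {z | fStar f a b z < ⊤}) (hm : Measurable h)
    (hb : ∀ y, h y ∈ Icc α β) (hν : ν ∈ Icc (α - zz f) (β - zz f)) :
    Integrable (fun y => fStarR f a b (h y - ν)) Q := by
  refine Integrable.of_mem_Icc (fStarR f a b (zz f - (β - α)))
    (fStarR f a b (zz f + (β - α)))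
    ((measurable_fStarR ha).comp (hm.sub_const ν)).aemeasurable (ae_of_all _ fun y => ?_)
  have := sub_mem_Icc (hb y) hν
  have hz' := lt_top_of_mem_interior hz
  exact ⟨fStarR_le_fStarR ha h1 this.1 ((monotone_fStar ha this.2).trans_lt hz'),
    fStarR_le_fStarR ha h1 this.2 hz'⟩

lemma cgf_le (ha : 0 ≤ a) (h1 : (1 : ℝ) ∈ Dom a b)
    (hz : zz f + (β - α) ∈ interior {z | fStar f a b z < ⊤}) (hm : Measurable h)
    (hb : ∀ y, h y ∈ Icc α β) (hν : ν ∈ Icc (α - zz f) (β - zz f)) :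
    cgf f a b Q h ≤ ((ν + ∫ y, fStarR f a b (h y - ν) ∂Q : ℝ) : EReal) := by
  refine (iInf_le _ ν).trans ?_
  rw [eIntegral, if_pos, EReal.coe_add]
  · rfl
  · exact ⟨ae_of_all _ fun y => ((monotone_fStar ha (sub_mem_Icc (hb y) hν).2).trans_lt
      (lt_top_of_mem_interior hz)).ne, integrable_fStarR_sub Q ha h1 hz hm hb hν⟩

lemma le_cgf (ha : 0 ≤ a) (h1 : (1 : ℝ) ∈ Dom a b) (hconv : ConvexOn ℝ (Dom a b) f)
    (hf1 : f 1 = 0) (hαβ : α ≤ β)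
    (hz : zz f + (β - α) ∈ interior {z | fStar f a b z < ⊤}) (hm : Measurable h)
    (hb : ∀ y, h y ∈ Icc α β)
    (hB : ∀ ν ∈ Icc (α - zz f) (β - zz f), B ≤ ν + ∫ y, fStarR f a b (h y - ν) ∂Q) :
    (B : EReal) ≤ cgf f a b Q h := by
  refine le_iInf fun ν => ?_
  rw [eIntegral]
  split_ifs with hfin
  swap
  · rw [EReal.coe_add_top]
    exact le_top
  rw [← EReal.coe_add, EReal.coe_le_coe_iff]
  have transfer : ∀ μ ∈ Icc (α - zz f) (β - zz f),
      (∀ y, fStar f a b (h y - ν) ≠ ⊤ →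
        fStarR f a b (h y - μ) + (μ - ν) ≤ fStarR f a b (h y - ν)) →
      B ≤ ν + ∫ y, (fStar f a b (h y - ν)).toReal ∂Q := fun μ hμ hle => by
    have hi := integrable_fStarR_sub Q ha h1 hz hm hb hμ
    have := integral_mono_ae (hi.add (integrable_const (μ - ν))) hfin.2
      (hfin.1.mono fun y hy => hle y hy)
    simp only [Pi.add_apply] at this
    rw [integral_add hi (integrable_const _)] at this
    simp only [integral_const, probReal_univ, one_smul] at this
    linarith [hB μ hμ]
  rcases lt_or_ge ν (α - zz f) with hν | hν
  · refine transfer (α - zz f) ⟨le_rfl, by linarith⟩ fun y hy => ?_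
    have := fStarR_add_le (x := h y - (α - zz f)) h1 hconv hf1 (by linarith [(hb y).1])
      (by linarith) (lt_top_iff_ne_top.2 hy)
    linarith
  rcases le_or_gt ν (β - zz f) with hν' | hν'
  · exact hB ν ⟨hν, hν'⟩
  · refine transfer (β - zz f) ⟨by linarith, le_rfl⟩ fun y _ => ?_
    have := fStarR_sub_le (x := h y - ν) (y := h y - (β - zz f)) ha h1 hconv hf1
      (by linarith) (by linarith [(hb y).2])
    linarith

lemma coe_cgfR (ha : 0 ≤ a) (h1 : (1 : ℝ) ∈ Dom a b) (hconv : ConvexOn ℝ (Dom a b) f)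
    (hf1 : f 1 = 0) (hαβ : α ≤ β)
    (hz : zz f + (β - α) ∈ interior {z | fStar f a b z < ⊤}) (hm : Measurable h)
    (hb : ∀ y, h y ∈ Icc α β) : (cgfR f a b Q h : EReal) = cgf f a b Q h := by
  refine EReal.coe_toReal (fun ht => ?_) (fun ht => ?_)
  · have := cgf_le Q ha h1 hz hm hb (ν := α - zz f) ⟨le_rfl, by linarith⟩
    rw [ht, top_le_iff] at this
    exact EReal.coe_ne_top _ this
  · have := le_cgf (B := α) Q ha h1 hconv hf1 hαβ hz hm hb fun ν hν => by
      have hi := integrable_fStarR_sub Q ha h1 hz hm hb hν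
      have := integral_mono (integrable_const (α - ν)) hi fun y =>
        (sub_le_sub_right (hb y).1 ν).trans (self_le_fStarR h1 hf1
          ((monotone_fStar ha (sub_mem_Icc (hb y) hν).2).trans_lt (lt_top_of_mem_interior hz)))
      simp only [integral_const, probReal_univ, one_smul] at this
      linarith
    rw [ht, le_bot_iff] at this
    exact EReal.coe_ne_bot _ this

lemma cgfR_sub_cgfR_le (Q' : Measure Y) [IsProbabilityMeasure Q'] (ha : 0 ≤ a)
    (h1 : (1 : ℝ) ∈ Dom a b) (hconv : ConvexOn ℝ (Dom a b) f) (hf1 : f 1 = 0) (hαβ : α ≤ β)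
    (hz : zz f + (β - α) ∈ interior {z | fStar f a b z < ⊤}) (hm : Measurable h)
    (hb : ∀ y, h y ∈ Icc α β)
    (hB : ∀ ν ∈ Icc (α - zz f) (β - zz f),
      ∫ y, fStarR f a b (h y - ν) ∂Q - ∫ y, fStarR f a b (h y - ν) ∂Q' ≤ B) :
    cgfR f a b Q h - cgfR f a b Q' h ≤ B := by
  have : ((cgfR f a b Q h - B : ℝ) : EReal) ≤ cgf f a b Q' h :=
    le_cgf Q' ha h1 hconv hf1 hαβ hz hm hb fun ν hν => by
      have h2 := cgf_le Q ha h1 hz hm hb hν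
      rw [← coe_cgfR Q ha h1 hconv hf1 hαβ hz hm hb, EReal.coe_le_coe_iff] at h2
      linarith [hB ν hν]
  rw [← coe_cgfR Q' ha h1 hconv hf1 hαβ hz hm hb, EReal.coe_le_coe_iff] at this
  linarith

end CumulantGenerating

section Empirical

variable {Y : Type*} [MeasurableSpace Y] {n : ℕ}

lemma isProbabilityMeasure_empMeas (hn : 0 < n) (y : Fin n → Y) :
    IsProbabilityMeasure (empMeas n y) := by
  refine ⟨?_⟩
  simp only [empMeas, Measure.smul_apply, Measure.finsetSum_apply, measure_univ, smul_eq_mul,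
    Finset.sum_const, Finset.card_univ, Fintype.card_fin, nsmul_eq_mul, mul_one]
  exact ENNReal.inv_mul_cancel (by simpa using hn.ne') (ENNReal.natCast_ne_top n)

lemma integral_empMeas (y : Fin n → Y) {g : Y → ℝ} (hg : Measurable g) :
    ∫ x, g x ∂(empMeas n y) = (n : ℝ)⁻¹ * ∑ j, g (y j) := by
  rw [empMeas, integral_smul_measure, integral_finsetSum_measure fun j _ =>
    integrable_dirac' hg.stronglyMeasurable (by simp)]
  simp only [integral_dirac' _ _ hg.stronglyMeasurable, smul_eq_mul, ENNReal.toReal_inv,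
    ENNReal.toReal_natCast]

end Empirical

section Symmetrization

lemma abs_ciSup_le {ι : Type*} [Nonempty ι] {g : ι → ℝ} {C : ℝ} (h : ∀ i, |g i| ≤ C) :
    |⨆ i, g i| ≤ C := by
  obtain ⟨i⟩ := ‹Nonempty ι›
  exact abs_le.2 ⟨(abs_le.1 (h i)).1.trans (le_ciSup (bddAbove_range_of_abs_le h) i),
    haveI : Nonempty ι := ⟨i⟩
    ciSup_le fun k => (abs_le.1 (h k)).2⟩

lemma integrable_ciSup {X ι : Type*} [MeasurableSpace X] [Countable ι] [Nonempty ι]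
    {g : ι → X → ℝ} {C : ℝ} (hm : ∀ i, Measurable (g i)) (hC : ∀ i x, |g i x| ≤ C)
    (μ : Measure X) [IsFiniteMeasure μ] : Integrable (fun x => ⨆ i, g i x) μ :=
  Integrable.of_bound (Measurable.iSup hm).aestronglyMeasurable C
    (ae_of_all _ fun x => abs_ciSup_le fun i => hC i x)

variable {Y ι : Type*} {n : ℕ} {φ : ι → Y → ℝ} {C : ℝ}

/-- The supremum of the signed sample means of a family of functions. -/
noncomputable def signedSup (φ : ι → Y → ℝ) (σ : Fin n → Bool) (y : Fin n → Y) : ℝ :=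
  ⨆ i, (n : ℝ)⁻¹ * ∑ j, boolSign (σ j) * φ i (y j)

lemma abs_inv_mul_le (hn : 0 < n) {x : ℝ} (hx : |x| ≤ n * C) : |(n : ℝ)⁻¹ * x| ≤ C := by
  have : (0 : ℝ) < n := by exact_mod_cast hn
  rw [abs_mul, abs_of_pos (inv_pos.2 this), inv_mul_le_iff₀ this]
  exact hx

lemma abs_mean_boolSign_le (hn : 0 < n) (hC : ∀ i y, |φ i y| ≤ C) (σ : Fin n → Bool)
    (y : Fin n → Y) (i : ι) : |(n : ℝ)⁻¹ * ∑ j, boolSign (σ j) * φ i (y j)| ≤ C :=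
  abs_inv_mul_le hn (abs_sum_boolSign_mul_le σ fun j => hC i (y j))

/-- The supremum of the signed mean differences between two samples. -/
noncomputable def signedDiffSup (φ : ι → Y → ℝ) (σ : Fin n → Bool)
    (w : (Fin n → Y) × (Fin n → Y)) : ℝ :=
  ⨆ i, (n : ℝ)⁻¹ * ∑ j, boolSign (σ j) * (φ i (w.2 j) - φ i (w.1 j))

lemma abs_mean_diff_le (hn : 0 < n) (hC : ∀ i y, |φ i y| ≤ C) (σ : Fin n → Bool)
    (w : (Fin n → Y) × (Fin n → Y)) (i : ι) :
    |(n : ℝ)⁻¹ * ∑ j, boolSign (σ j) * (φ i (w.2 j) - φ i (w.1 j))| ≤ C + C :=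
  abs_inv_mul_le hn (abs_sum_boolSign_mul_le σ fun _ =>
    (abs_sub _ _).trans (add_le_add (hC i _) (hC i _)))

lemma signedDiffSup_le [Nonempty ι] (hn : 0 < n) (hC : ∀ i y, |φ i y| ≤ C) (σ : Fin n → Bool)
    (w : (Fin n → Y) × (Fin n → Y)) :
    signedDiffSup φ σ w ≤ signedSup φ σ w.2 + signedSup φ (fun j => !σ j) w.1 := by
  refine ciSup_le fun i => ?_
  have h1 := le_ciSup (bddAbove_range_of_abs_le (abs_mean_boolSign_le hn hC σ w.2)) i
  have h2 := le_ciSup (bddAbove_range_of_abs_le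
    (abs_mean_boolSign_le hn hC (fun j => !σ j) w.1)) i
  refine le_trans (le_of_eq ?_) (add_le_add h1 h2)
  rw [← mul_add, ← Finset.sum_add_distrib]
  congr 1
  refine Finset.sum_congr rfl fun j _ => ?_
  cases σ j <;> simp [boolSign] <;> ring

variable [MeasurableSpace Y]

lemma measurable_mean_boolSign (hm : ∀ i, Measurable (φ i)) (σ : Fin n → Bool) (i : ι) :
    Measurable fun y : Fin n → Y => (n : ℝ)⁻¹ * ∑ j, boolSign (σ j) * φ i (y j) :=
  (Finset.measurable_fun_sum _ fun j _ =>
    ((hm i).comp (measurable_pi_apply j)).const_mul _).const_mul _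

lemma measurable_mean_diff (hm : ∀ i, Measurable (φ i)) (σ : Fin n → Bool) (i : ι) :
    Measurable fun w : (Fin n → Y) × (Fin n → Y) =>
      (n : ℝ)⁻¹ * ∑ j, boolSign (σ j) * (φ i (w.2 j) - φ i (w.1 j)) :=
  (Finset.measurable_fun_sum _ fun j _ =>
    (((hm i).comp ((measurable_pi_apply j).comp measurable_snd)).sub
      ((hm i).comp ((measurable_pi_apply j).comp measurable_fst))).const_mul _).const_mul _

variable [Countable ι]

/-- Swapping the coordinates of two i.i.d. samples does not change the joint law. -/
lemma integral_signedDiffSup (P : Measure Y) [IsProbabilityMeasure P]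
    (hm : ∀ i, Measurable (φ i)) (σ : Fin n → Bool) :
    ∫ w, signedDiffSup φ σ w
        ∂((Measure.pi fun _ : Fin n => P).prod (Measure.pi fun _ : Fin n => P)) =
      ∫ w, signedDiffSup φ (fun _ => true) w
        ∂((Measure.pi fun _ : Fin n => P).prod (Measure.pi fun _ : Fin n => P)) := by
  have he := measurePreserving_arrowProdEquivProdArrow Y Y (Fin n) (fun _ => P) (fun _ => P)
  have hS : MeasurePreserving
      (fun (v : Fin n → Y × Y) j => (if σ j then id else Prod.swap : Y × Y → Y × Y) (v j))
      (Measure.pi fun _ => P.prod P) (Measure.pi fun _ => P.prod P) :=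
    measurePreserving_pi _ _ fun j => by
      split_ifs
      · exact MeasurePreserving.id _
      · exact Measure.measurePreserving_swap
  have hmeas : ∀ τ : Fin n → Bool, Measurable (signedDiffSup φ τ) := fun τ =>
    Measurable.iSup (measurable_mean_diff hm τ)
  rw [← he.map_eq, integral_map he.measurable.aemeasurable (hmeas _).aestronglyMeasurable,
    integral_map he.measurable.aemeasurable (hmeas _).aestronglyMeasurable]
  conv_rhs => rw [← hS.map_eq]
  have hcomp : Measurable fun v => signedDiffSup φ (fun _ => true)
      (MeasurableEquiv.arrowProdEquivProdArrow Y Y (Fin n) v) := (hmeas _).comp he.measurable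
  rw [integral_map hS.measurable.aemeasurable hcomp.aestronglyMeasurable]
  refine integral_congr_ae (ae_of_all _ fun v => iSup_congr fun i => ?_)
  congr 1
  refine Finset.sum_congr rfl fun j _ => ?_
  simp only [MeasurableEquiv.arrowProdEquivProdArrow, MeasurableEquiv.coe_mk,
    Equiv.arrowProdEquivProdArrow, Equiv.coe_fn_mk]
  cases σ j <;> simp [boolSign]

variable [Nonempty ι]

lemma integrable_signedSup (hn : 0 < n) (hm : ∀ i, Measurable (φ i)) (hC : ∀ i y, |φ i y| ≤ C)
    (σ : Fin n → Bool) (μ : Measure (Fin n → Y)) [IsFiniteMeasure μ] :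
    Integrable (signedSup φ σ) μ :=
  integrable_ciSup (measurable_mean_boolSign hm σ)
    (fun i y => abs_mean_boolSign_le hn hC σ y i) μ

lemma integrable_signedDiffSup (hn : 0 < n) (hm : ∀ i, Measurable (φ i))
    (hC : ∀ i y, |φ i y| ≤ C) (σ : Fin n → Bool) (μ : Measure ((Fin n → Y) × (Fin n → Y)))
    [IsFiniteMeasure μ] : Integrable (signedDiffSup φ σ) μ :=
  integrable_ciSup (measurable_mean_diff hm σ) (fun i w => abs_mean_diff_le hn hC σ w i) μ

variable (P : Measure Y) [IsProbabilityMeasure P]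

lemma integral_pi_eval (j : Fin n) {g : Y → ℝ} (hg : Measurable g) :
    ∫ y, g (y j) ∂(Measure.pi fun _ : Fin n => P) = ∫ x, g x ∂P := by
  have h := measurePreserving_eval (fun _ : Fin n => P) j
  conv_rhs => rw [← h.map_eq]
  rw [integral_map h.measurable.aemeasurable hg.aestronglyMeasurable]

lemma ciSup_sub_mean_le (hn : 0 < n) (hm : ∀ i, Measurable (φ i)) (hC : ∀ i y, |φ i y| ≤ C)
    (y : Fin n → Y) :
    ⨆ i, (∫ x, φ i x ∂P - (n : ℝ)⁻¹ * ∑ j, φ i (y j)) ≤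
      ∫ yy, signedDiffSup φ (fun _ => true) (y, yy) ∂(Measure.pi fun _ : Fin n => P) := by
  refine ciSup_le fun i => ?_
  have hn' : (n : ℝ) ≠ 0 := by exact_mod_cast hn.ne'
  have hint : ∀ j, Integrable (fun yy : Fin n → Y => φ i (yy j) - φ i (y j))
      (Measure.pi fun _ : Fin n => P) := fun j =>
    Integrable.of_bound (((hm i).comp (measurable_pi_apply j)).sub_const _).aestronglyMeasurable
      (C + C) (ae_of_all _ fun yy => (abs_sub _ _).trans (add_le_add (hC i _) (hC i _)))
  have hint' : ∀ j, Integrable (fun yy : Fin n → Y => φ i (yy j))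
      (Measure.pi fun _ : Fin n => P) := fun j =>
    Integrable.of_bound ((hm i).comp (measurable_pi_apply j)).aestronglyMeasurable
      C (ae_of_all _ fun yy => hC i _)
  have e : ∫ x, φ i x ∂P - (n : ℝ)⁻¹ * ∑ j, φ i (y j) =
      ∫ yy : Fin n → Y, (n : ℝ)⁻¹ * ∑ j, boolSign true * (φ i (yy j) - φ i (y j))
        ∂(Measure.pi fun _ : Fin n => P) := by
    simp only [boolSign, if_true, one_mul]
    rw [integral_const_mul, integral_finsetSum _ fun j _ => hint j]
    simp only [integral_sub (hint' _) (integrable_const _), integral_pi_eval P _ (hm i),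
      integral_const, probReal_univ, one_smul, Finset.sum_sub_distrib, Finset.sum_const,
      Finset.card_univ, Fintype.card_fin, nsmul_eq_mul]
    field_simp
  rw [e]
  have hpm : Measurable fun yy : Fin n → Y => (y, yy) := measurable_prodMk_left
  refine integral_mono ((integrable_finsetSum _ fun j _ => (hint j).const_mul _).const_mul _)
    (integrable_ciSup (fun k => (measurable_mean_diff hm (fun _ => true) k).comp hpm)
      (fun k yy => abs_mean_diff_le hn hC (fun _ => true) (y, yy) k) _) fun yy => ?_
  exact le_ciSup (bddAbove_range_of_abs_le
    (abs_mean_diff_le hn hC (fun _ => true) (y, yy))) i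

/-- Symmetrization: the expected uniform deviation is at most twice the Rademacher average. -/
lemma integral_ciSup_sub_mean_le (hn : 0 < n) (hm : ∀ i, Measurable (φ i))
    (hC : ∀ i y, |φ i y| ≤ C) :
    ∫ y, (⨆ i, (∫ x, φ i x ∂P - (n : ℝ)⁻¹ * ∑ j, φ i (y j)))
        ∂(Measure.pi fun _ : Fin n => P) ≤
      2 * ∫ y, (2 ^ n : ℝ)⁻¹ * ∑ σ : Fin n → Bool, signedSup φ σ y
        ∂(Measure.pi fun _ : Fin n => P) := by
  set μ := Measure.pi fun _ : Fin n => P with hμ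
  have hI := fun σ => integrable_signedDiffSup hn hm hC σ (μ.prod μ)
  have hA := fun σ => integrable_signedSup hn hm hC σ μ
  have hPC : ∀ i, |∫ x, φ i x ∂P| ≤ C := fun i => by
    simpa using norm_integral_le_of_norm_le_const (f := φ i) (μ := P)
      (ae_of_all _ fun x => hC i x)
  have hL : Integrable
      (fun y : Fin n → Y => ⨆ i, (∫ x, φ i x ∂P - (n : ℝ)⁻¹ * ∑ j, φ i (y j))) μ := by
    refine integrable_ciSup (C := C + C) (fun i => ?_) (fun i y => ?_) μ
    · exact ((Finset.measurable_fun_sum _ fun j _ =>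
        (hm i).comp (measurable_pi_apply j)).const_mul _).const_sub _
    · have := abs_mean_boolSign_le hn hC (fun _ => true) y i
      simp only [boolSign, if_true, one_mul] at this
      exact (abs_sub _ _).trans (add_le_add (hPC i) this)
  have h1 : ∫ y, (⨆ i, (∫ x, φ i x ∂P - (n : ℝ)⁻¹ * ∑ j, φ i (y j))) ∂μ ≤
      ∫ w, signedDiffSup φ (fun _ => true) w ∂(μ.prod μ) := by
    rw [integral_prod _ (hI _)]
    exact integral_mono hL (hI _).integral_prod_left (ciSup_sub_mean_le P hn hm hC)
  have h2 : ∀ σ, ∫ w, signedDiffSup φ (fun _ => true) w ∂(μ.prod μ) ≤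
      ∫ y, signedSup φ σ y ∂μ + ∫ y, signedSup φ (fun j => !σ j) y ∂μ := fun σ => by
    rw [← integral_signedDiffSup P hm σ]
    refine (integral_mono (hI σ) ((hA σ).comp_snd μ |>.add ((hA _).comp_fst μ))
      (signedDiffSup_le hn hC σ)).trans (le_of_eq ?_)
    simp only [Pi.add_apply]
    rw [integral_add ((hA σ).comp_snd μ) ((hA _).comp_fst μ), integral_fun_snd,
      integral_fun_fst]
    simp
  have h3 := Finset.sum_le_sum fun (σ : Fin n → Bool) (_ : σ ∈ Finset.univ) => h2 σ
  have h4 := (Equiv.piCongrRight fun _ : Fin n => Equiv.boolNot).sum_comp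
    fun σ => ∫ y, signedSup φ σ y ∂μ
  change ∑ σ : Fin n → Bool, ∫ y, signedSup φ (fun j => !σ j) y ∂μ = _ at h4
  rw [Finset.sum_add_distrib, h4] at h3
  simp only [Finset.sum_const, Finset.card_univ, Fintype.card_pi, Fintype.card_bool,
    Finset.prod_const, Fintype.card_fin, nsmul_eq_mul, Nat.cast_pow, Nat.cast_ofNat] at h3
  rw [integral_const_mul, integral_finsetSum _ fun σ _ => hA σ]
  refine h1.trans ?_
  rw [← mul_assoc, mul_comm 2, mul_assoc, le_inv_mul_iff₀ (by positivity)]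
  linarith

end Symmetrization

section RademacherSum

variable {ι κ : Type*} {n : ℕ} {v w u : ι → Fin n → ℝ} {C K : ℝ}

/-- The sum over all sign patterns of the supremum of the signed means of a family of vectors. -/
noncomputable def rademacherSum (v : ι → Fin n → ℝ) : ℝ :=
  ∑ σ : Fin n → Bool, ⨆ i, (n : ℝ)⁻¹ * ∑ j, boolSign (σ j) * v i j

lemma bddAbove_range_mean (hv : ∀ i j, |v i j| ≤ C) (σ : Fin n → Bool) :
    BddAbove (range fun i => (n : ℝ)⁻¹ * ∑ j, boolSign (σ j) * v i j) :=
  bddAbove_range_of_abs_le (C := (n : ℝ)⁻¹ * (n * C)) fun i => by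
    rw [abs_mul, abs_of_nonneg (by positivity)]
    exact mul_le_mul_of_nonneg_left (abs_sum_boolSign_mul_le σ (hv i)) (by positivity)

lemma rademacherSum_comp_le [Nonempty κ] (g : κ → ι) (hu : ∀ i j, |u i j| ≤ C) :
    rademacherSum (fun k => u (g k)) ≤ rademacherSum u :=
  Finset.sum_le_sum fun σ _ => ciSup_le fun k =>
    le_ciSup (bddAbove_range_mean hu σ) (g k)

variable [Nonempty ι]

lemma rademacherSum_le_mul (hK : 0 ≤ K) {C' : ℝ} (hv : ∀ i j, |v i j| ≤ C)
    (hu : ∀ i j, |u i j| ≤ C') (h : ∀ i k j, |v i j - v k j| ≤ K * |u i j - u k j|) :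
    rademacherSum v ≤ K * rademacherSum u := by
  have hn : (0 : ℝ) ≤ (n : ℝ)⁻¹ := by positivity
  have key := sum_ciSup_contraction (K := 0) (C := max ((n : ℝ)⁻¹ * C) (K * ((n : ℝ)⁻¹ * C')))
    (fun _ : ι => 0) (fun i j => (n : ℝ)⁻¹ * v i j) (fun i j => K * ((n : ℝ)⁻¹ * u i j))
    (fun i => by simp)
    (fun i j => le_max_of_le_left (by
      rw [abs_mul, abs_of_nonneg hn]
      exact mul_le_mul_of_nonneg_left (hv i j) hn))
    (fun i j => le_max_of_le_right (by
      rw [abs_mul, abs_mul, abs_of_nonneg hn, abs_of_nonneg hK]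
      exact mul_le_mul_of_nonneg_left (mul_le_mul_of_nonneg_left (hu i j) hn) hK))
    (fun i k j => by
      rw [← mul_sub, ← mul_sub, ← mul_sub, abs_mul, abs_mul, abs_mul, abs_of_nonneg hn,
        abs_of_nonneg hK, mul_left_comm]
      exact mul_le_mul_of_nonneg_left (h i k j) hn)
  rw [rademacherSum, rademacherSum, Finset.mul_sum]
  refine (le_of_eq ?_).trans (key.trans (le_of_eq ?_))
  · refine Finset.sum_congr rfl fun σ _ => iSup_congr fun i => ?_
    rw [zero_add, Finset.mul_sum]
    exact Finset.sum_congr rfl fun j _ => by ring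
  · refine Finset.sum_congr rfl fun σ _ => ?_
    rw [Real.mul_iSup_of_nonneg hK]
    refine iSup_congr fun i => ?_
    rw [zero_add, Finset.mul_sum, Finset.mul_sum]
    exact Finset.sum_congr rfl fun j _ => by ring

lemma rademacherSum_nonneg (hu : ∀ i j, |u i j| ≤ C) : 0 ≤ rademacherSum u := by
  have := rademacherSum_le_mul (v := fun (_ : ι) (_ : Fin n) => (0 : ℝ)) (u := u) zero_le_one
    (C := 0) (fun _ _ => by simp) hu fun _ _ _ => by simp
  simpa [rademacherSum] using this

lemma rademacherSum_add_le {C' : ℝ} (hv : ∀ i j, |v i j| ≤ C) (hw : ∀ i j, |w i j| ≤ C') :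
    rademacherSum (fun i j => v i j + w i j) ≤ rademacherSum v + rademacherSum w := by
  rw [rademacherSum, rademacherSum, rademacherSum, ← Finset.sum_add_distrib]
  refine Finset.sum_le_sum fun σ _ => ciSup_le fun i => ?_
  simp only [mul_add, Finset.sum_add_distrib]
  exact add_le_add (le_ciSup (bddAbove_range_mean hv σ) i)
    (le_ciSup (bddAbove_range_mean hw σ) i)

lemma rademacherSum_const_le (hn : 0 < n) {r : ι → ℝ} {m D : ℝ} (hr : ∀ i, |r i - m| ≤ D) :
    rademacherSum (fun i (_ : Fin n) => r i) ≤ 2 ^ n * (D / Real.sqrt n) := by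
  have hn' : (0 : ℝ) < n := by exact_mod_cast hn
  have hD : 0 ≤ D := (abs_nonneg _).trans (hr (Classical.arbitrary ι))
  calc rademacherSum (fun i (_ : Fin n) => r i)
      ≤ ∑ σ : Fin n → Bool, ((n : ℝ)⁻¹ * m * ∑ j, boolSign (σ j) +
          (n : ℝ)⁻¹ * D * |∑ j, boolSign (σ j)|) := by
        refine Finset.sum_le_sum fun σ _ => ciSup_le fun i => ?_
        rw [← Finset.sum_mul]
        have h1 : (∑ j, boolSign (σ j)) * (r i - m) ≤ D * |∑ j, boolSign (σ j)| := by
          refine (le_abs_self _).trans ?_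
          rw [abs_mul, mul_comm]
          exact mul_le_mul_of_nonneg_right (hr i) (abs_nonneg _)
        have h2 := mul_le_mul_of_nonneg_left h1 (inv_pos.2 hn').le
        linarith
    _ = (n : ℝ)⁻¹ * D * ∑ σ : Fin n → Bool, |∑ j, boolSign (σ j)| := by
        rw [Finset.sum_add_distrib, ← Finset.mul_sum, ← Finset.mul_sum, sum_sum_boolSign,
          mul_zero, zero_add]
    _ ≤ (n : ℝ)⁻¹ * D * (2 ^ n * Real.sqrt n) :=
        mul_le_mul_of_nonneg_left (sum_abs_sum_boolSign_le n) (by positivity)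
    _ = 2 ^ n * (D / Real.sqrt n) := by
        have h1 : Real.sqrt n ≠ 0 := (Real.sqrt_pos.2 hn').ne'
        have h2 := Real.sq_sqrt hn'.le
        rw [← h2, inv_mul_eq_div, Real.sqrt_sq (Real.sqrt_nonneg _)]
        field_simp

/-- Rademacher sum of the family `c u + G (u - r)` with `G` Lipschitz. -/
lemma rademacherSum_shift_le [Nonempty κ] (hn : 0 < n) (hu : ∀ i j, |u i j| ≤ C) {r : κ → ℝ}
    {m D s c : ℝ} (hr : ∀ k, |r k - m| ≤ D) (hs : |s| = 1) (hc : 0 ≤ c) {G : ℝ → ℝ} {M : ℝ≥0}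
    (hG : LipschitzWith M G) {C' : ℝ} (hGC : ∀ i k j, |G (u i j - r k)| ≤ C') :
    rademacherSum (fun (p : ι × κ) j => s * (c * u p.1 j + G (u p.1 j - r p.2))) ≤
      (c + M) * rademacherSum u + M * (2 ^ n * (D / Real.sqrt n)) := by
  have hrC : ∀ k, |r k| ≤ D + |m| := fun k => by
    have := abs_add_le (r k - m) m
    rw [sub_add_cancel] at this
    linarith [hr k]
  have h0 : rademacherSum (fun (p : ι × κ) j => s * (c * u p.1 j + G (u p.1 j - r p.2))) ≤
      rademacherSum (fun (p : ι × κ) j => s * (c * u p.1 j)) +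
        rademacherSum (fun (p : ι × κ) j => s * G (u p.1 j - r p.2)) := by
    simp only [mul_add]
    refine rademacherSum_add_le (C := c * C) (C' := C') (fun p j => ?_) (fun p j => ?_)
    · rw [abs_mul, hs, one_mul, abs_mul, abs_of_nonneg hc]
      exact mul_le_mul_of_nonneg_left (hu _ _) hc
    · rw [abs_mul, hs, one_mul]
      exact hGC _ _ _
  have h1 : rademacherSum (fun (p : ι × κ) j => s * (c * u p.1 j)) ≤
      c * rademacherSum (fun (p : ι × κ) j => u p.1 j) := by
    refine rademacherSum_le_mul (C := c * C) hc (fun p j => ?_) (fun p j => hu _ _)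
      fun p q j => ?_
    · rw [abs_mul, hs, one_mul, abs_mul, abs_of_nonneg hc]
      exact mul_le_mul_of_nonneg_left (hu _ _) hc
    · rw [← mul_sub, ← mul_sub, abs_mul, hs, one_mul, abs_mul, abs_of_nonneg hc]
  have h2 : rademacherSum (fun (p : ι × κ) j => s * G (u p.1 j - r p.2)) ≤
      M * rademacherSum (fun (p : ι × κ) j => u p.1 j - r p.2) := by
    refine rademacherSum_le_mul (C := C') (C' := C + (D + |m|)) M.2 (fun p j => ?_)
      (fun p j => (abs_sub _ _).trans (add_le_add (hu _ _) (hrC _))) fun p q j => ?_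
    · rw [abs_mul, hs, one_mul]
      exact hGC _ _ _
    · rw [← mul_sub, abs_mul, hs, one_mul]
      exact hG.dist_le_mul _ _
  have h3 : rademacherSum (fun (p : ι × κ) j => u p.1 j - r p.2) ≤
      rademacherSum (fun (p : ι × κ) j => u p.1 j) +
        rademacherSum (fun (p : ι × κ) (_ : Fin n) => -r p.2) := by
    simp only [sub_eq_add_neg]
    exact rademacherSum_add_le (C' := D + |m|) (fun p j => hu _ _) fun p j => by
      rw [abs_neg]; exact hrC _
  have h4 : rademacherSum (fun (p : ι × κ) j => u p.1 j) ≤ rademacherSum u :=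
    rademacherSum_comp_le Prod.fst hu
  have h5 := rademacherSum_const_le hn (r := fun p : ι × κ => -r p.2) (m := -m) (D := D)
    fun p => by
      rw [neg_sub_neg, abs_sub_comm]
      exact hr _
  have h6 := mul_le_mul_of_nonneg_left h4 hc
  have h7 := mul_le_mul_of_nonneg_left (h3.trans (add_le_add h4 h5)) M.2
  have h8 : (0 : ℝ) ≤ M := M.2
  simp only [NNReal.val_eq_coe] at h7
  linarith

end RademacherSum

section UniformDeviation

variable {Y : Type*} {n : ℕ} {Ψ : Set (Y → ℝ)} {α β : ℝ}

lemma abs_le_of_mem_Icc {v : ℝ} (hv : v ∈ Icc α β) : |v| ≤ |α| + |β| :=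
  (abs_le_max_abs_abs hv.1 hv.2).trans
    (max_le_add_of_nonneg (abs_nonneg _) (abs_nonneg _))

lemma empRad_eq (y : Fin n → Y) :
    empRad Ψ n y = (2 ^ n : ℝ)⁻¹ * rademacherSum fun (k : Ψ) j => k.1 (y j) := by
  rw [empRad, rademacherSum]
  congr 1
  refine Finset.sum_congr rfl fun σ _ => ?_
  rw [iSup]
  congr 1
  ext r
  constructor
  · rintro ⟨ψ, hψ, rfl⟩
    exact ⟨⟨ψ, hψ⟩, rfl⟩
  · rintro ⟨k, rfl⟩
    exact ⟨k.1, k.2, rfl⟩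

lemma empRad_nonneg (hne : Ψ.Nonempty) (hbd : ∀ ψ ∈ Ψ, ∀ y, ψ y ∈ Icc α β) (y : Fin n → Y) :
    0 ≤ empRad Ψ n y := by
  have := hne.to_subtype
  rw [empRad_eq]
  exact mul_nonneg (by positivity)
    (rademacherSum_nonneg fun k j => abs_le_of_mem_Icc (hbd k.1 k.2 (y j)))

lemma rad_nonneg [MeasurableSpace Y] (hne : Ψ.Nonempty) (hbd : ∀ ψ ∈ Ψ, ∀ y, ψ y ∈ Icc α β)
    (P : Measure Y) : 0 ≤ rad Ψ P n :=
  integral_nonneg fun y => empRad_nonneg hne hbd y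

/-- The integrand of the variational formula, indexed by a test function and a shift. -/
def shifted (c s : ℝ) (G : ℝ → ℝ) (ψ : Y → ℝ) (ν : ℝ) (x : Y) : ℝ :=
  s * (c * ψ x + G (ψ x - ν))

lemma LipschitzWith.abs_le_of_abs_le {G : ℝ → ℝ} {M : ℝ≥0} (hG : LipschitzWith M G) {x B : ℝ}
    (hx : |x| ≤ B) : |G x| ≤ |G 0| + M * B := by
  have h := hG.dist_le_mul x 0
  rw [Real.dist_eq, Real.dist_eq, sub_zero] at h
  have h2 := abs_add_le (G x - G 0) (G 0)
  rw [sub_add_cancel] at h2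
  have h3 := mul_le_mul_of_nonneg_left hx M.coe_nonneg
  linarith

variable {c s : ℝ} {G : ℝ → ℝ} {M : ℝ≥0} {z₀ : ℝ}

lemma exists_abs_shifted_le (hbd : ∀ ψ ∈ Ψ, ∀ y, ψ y ∈ Icc α β) (hG : LipschitzWith M G) :
    ∃ C, ∀ ψ ∈ Ψ, ∀ ν ∈ Icc (α - z₀) (β - z₀), ∀ x, |G (ψ x - ν)| ≤ C ∧
      |shifted c s G ψ ν x| ≤ |s| * (|c| * (|α| + |β|) + C) := by
  refine ⟨|G 0| + M * (|z₀ - (β - α)| + |z₀ + (β - α)|), fun ψ hψ ν hν x => ?_⟩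
  have h := hG.abs_le_of_abs_le (abs_le_of_mem_Icc (sub_mem_Icc (hbd ψ hψ x) hν))
  refine ⟨h, ?_⟩
  rw [shifted, abs_mul]
  refine mul_le_mul_of_nonneg_left ((abs_add_le _ _).trans (add_le_add ?_ h)) (abs_nonneg s)
  rw [abs_mul]
  exact mul_le_mul_of_nonneg_left (abs_le_of_mem_Icc (hbd ψ hψ x)) (abs_nonneg c)

variable [MeasurableSpace Y]

lemma measurable_shifted {ψ : Y → ℝ} (hψ : Measurable ψ) (hG : LipschitzWith M G) (ν : ℝ) :
    Measurable (shifted c s G ψ ν) :=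
  ((hψ.const_mul c).add (hG.continuous.measurable.comp (hψ.sub_const ν))).const_mul s

variable (P : Measure Y) [IsProbabilityMeasure P]

lemma integral_ciSup_shifted_le (hΨc : Ψ.Countable) (hne : Ψ.Nonempty)
    (hΨm : ∀ ψ ∈ Ψ, Measurable ψ) (hbd : ∀ ψ ∈ Ψ, ∀ y, ψ y ∈ Icc α β)
    (hG : LipschitzWith M G) (hc : 0 ≤ c) (hs : |s| = 1) (hn : 0 < n) {r : ℕ → ℝ}
    (hr : ∀ k, r k ∈ Icc (α - z₀) (β - z₀)) :
    ∫ y, (⨆ p : Ψ × ℕ, (∫ x, shifted c s G p.1.1 (r p.2) x ∂P -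
        (n : ℝ)⁻¹ * ∑ j, shifted c s G p.1.1 (r p.2) (y j))) ∂(Measure.pi fun _ : Fin n => P) ≤
      2 * ((c + M) * rad Ψ P n + M * ((β - α) / (2 * Real.sqrt n))) := by
  have := hne.to_subtype
  have := hΨc.to_subtype
  obtain ⟨C, hC⟩ := exists_abs_shifted_le (c := c) (s := s) (z₀ := z₀) hbd hG
  have hm : ∀ p : Ψ × ℕ, Measurable (shifted c s G p.1.1 (r p.2)) := fun p =>
    measurable_shifted (hΨm _ p.1.2) hG _
  have hS : ∀ (p : Ψ × ℕ) x, |shifted c s G p.1.1 (r p.2) x| ≤ _ := fun p x =>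
    (hC _ p.1.2 _ (hr p.2) x).2
  refine (integral_ciSup_sub_mean_le P hn hm hS).trans
    (mul_le_mul_of_nonneg_left ?_ zero_le_two)
  have hpt : ∀ y : Fin n → Y, (2 ^ n : ℝ)⁻¹ *
      ∑ σ : Fin n → Bool, signedSup (fun p : Ψ × ℕ => shifted c s G p.1.1 (r p.2)) σ y ≤
      (c + M) * empRad Ψ n y + M * ((β - α) / (2 * Real.sqrt n)) := fun y => by
    have h := rademacherSum_shift_le (u := fun (k : Ψ) j => k.1 (y j)) (r := r)
      (m := (α + β) / 2 - z₀) (D := (β - α) / 2) hn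
      (fun k j => abs_le_of_mem_Icc (hbd k.1 k.2 (y j)))
      (fun k => abs_le.2 ⟨by linarith [(hr k).1], by linarith [(hr k).2]⟩) hs hc hG
      (fun i k j => (hC _ i.2 _ (hr k) (y j)).1)
    rw [empRad_eq, inv_mul_le_iff₀ (by positivity)]
    refine h.trans (le_of_eq ?_)
    rw [mul_add, div_div]
    field_simp
  have hrad : Integrable (fun y => empRad Ψ n y) (Measure.pi fun _ : Fin n => P) := by
    simp only [empRad_eq, rademacherSum]
    exact (integrable_finsetSum _ fun σ _ => integrable_signedSup
      (φ := fun k : Ψ => k.1) hn (fun k => hΨm _ k.2)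
      (fun k y => abs_le_of_mem_Icc (hbd _ k.2 y)) σ _).const_mul _
  refine (integral_mono ((integrable_finsetSum _ fun σ _ =>
    integrable_signedSup hn hm hS σ _).const_mul _)
    ((hrad.const_mul _).add (integrable_const _)) hpt).trans (le_of_eq ?_)
  simp only [Pi.add_apply]
  rw [integral_add (hrad.const_mul _) (integrable_const _), integral_const_mul]
  simp [rad]

lemma continuous_integral_shifted {ψ : Y → ℝ} (hψ : ψ ∈ Ψ) (hψm : Measurable ψ)
    (hbd : ∀ ψ ∈ Ψ, ∀ y, ψ y ∈ Icc α β) (hG : LipschitzWith M G) :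
    Continuous fun ν : Icc (α - z₀) (β - z₀) => ∫ x, shifted c s G ψ ν x ∂P := by
  obtain ⟨C, hC⟩ := exists_abs_shifted_le (c := c) (s := s) (z₀ := z₀) hbd hG
  refine continuous_of_dominated (bound := fun _ => |s| * (|c| * (|α| + |β|) + C))
    (fun ν => (measurable_shifted hψm hG ν).aestronglyMeasurable)
    (fun ν => ae_of_all _ fun x => (hC ψ hψ ν ν.2 x).2) (integrable_const _)
    (ae_of_all _ fun x => ?_)
  have := hG.continuous
  simp only [shifted]
  fun_prop

lemma integral_shifted {f : ℝ → ℝ} {a : ℝ} {b : EReal} (ha : 0 ≤ a)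
    (h1 : (1 : ℝ) ∈ Dom a b)
    (hz : zz f + (β - α) ∈ interior {z | fStar f a b z < ⊤})
    (hGf : ∀ x ∈ Icc (zz f - (β - α)) (zz f + (β - α)), fStarR f a b x = c * x + G x)
    {ψ : Y → ℝ} (hψm : Measurable ψ) (hb : ∀ y, ψ y ∈ Icc α β) {ν : ℝ}
    (hν : ν ∈ Icc (α - zz f) (β - zz f)) :
    ∫ x, shifted c s G ψ ν x ∂P = s * (∫ x, fStarR f a b (ψ x - ν) ∂P + c * ν) := by
  have e : ∀ x, shifted c s G ψ ν x = s * (fStarR f a b (ψ x - ν) + c * ν) := fun x => by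
    rw [shifted, hGf _ (sub_mem_Icc (hb x) hν)]
    ring
  simp only [e]
  rw [integral_const_mul, integral_add (integrable_fStarR_sub P ha h1 hz hψm hb hν)
    (integrable_const _)]
  simp

/-- Uniform deviation bound for the cumulant generating function when the Legendre transform is
a linear function plus a Lipschitz one on the relevant interval. -/
lemma integral_sSup_cgfR_sub_le {f : ℝ → ℝ} {a : ℝ} {b : EReal} (ha : 0 ≤ a)
    (h1 : (1 : ℝ) ∈ Dom a b) (hconv : ConvexOn ℝ (Dom a b) f) (hf1 : f 1 = 0) (hαβ : α ≤ β)
    (hz : zz f + (β - α) ∈ interior {z | fStar f a b z < ⊤})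
    (hΨc : Ψ.Countable) (hne : Ψ.Nonempty)
    (hΨm : ∀ ψ ∈ Ψ, Measurable ψ) (hbd : ∀ ψ ∈ Ψ, ∀ y, ψ y ∈ Icc α β)
    (hc : 0 ≤ c)
    (hG : LipschitzOnWith M (fun x => fStarR f a b x - c * x)
      (Icc (zz f - (β - α)) (zz f + (β - α))))
    (hn : 0 < n) (hs : s = 1 ∨ s = -1) :
    (∫ y : Fin n → Y,
        sSup {r : ℝ | ∃ ψ ∈ Ψ, r = s * (cgfR f a b P ψ - cgfR f a b (empMeas n y) ψ)}
        ∂(Measure.pi fun _ : Fin n => P)) ≤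
      2 * ((c + M) * rad Ψ P n + M * ((β - α) / (2 * Real.sqrt n))) := by
  have hs1 : |s| = 1 := by rcases hs with rfl | rfl <;> simp
  obtain ⟨G, hG, hGf⟩ := hG.extend_real
  have hGf' : ∀ x ∈ Icc (zz f - (β - α)) (zz f + (β - α)), fStarR f a b x = c * x + G x :=
    fun x hx => by
      have := hGf hx
      simp only at this
      linarith
  have hneT : Nonempty (Icc (α - zz f) (β - zz f)) := ⟨⟨α - zz f, le_rfl, by linarith⟩⟩
  set r : ℕ → Icc (α - zz f) (β - zz f) := TopologicalSpace.denseSeq _ with hr_def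
  have main := integral_ciSup_shifted_le (z₀ := zz f) P hΨc hne hΨm hbd hG hc hs1 hn
    (r := fun k => (r k : ℝ)) fun k => (r k).2
  by_cases hint : Integrable (fun y : Fin n → Y =>
      sSup {r : ℝ | ∃ ψ ∈ Ψ, r = s * (cgfR f a b P ψ - cgfR f a b (empMeas n y) ψ)})
      (Measure.pi fun _ : Fin n => P)
  swap
  · rw [integral_undef hint]
    have := rad_nonneg (n := n) hne hbd P
    have := sub_nonneg.2 hαβ
    positivity
  refine le_trans ?_ main
  have := hne.to_subtype
  have := hΨc.to_subtype
  obtain ⟨C, hC⟩ := exists_abs_shifted_le (c := c) (s := s) (z₀ := zz f) hbd hG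
  have hm : ∀ p : Ψ × ℕ, Measurable (shifted c s G p.1.1 (r p.2)) := fun p =>
    measurable_shifted (hΨm _ p.1.2) hG _
  have hB : ∀ (p : Ψ × ℕ) (y : Fin n → Y), |∫ x, shifted c s G p.1.1 (r p.2) x ∂P -
      (n : ℝ)⁻¹ * ∑ j, shifted c s G p.1.1 (r p.2) (y j)| ≤
      |s| * (|c| * (|α| + |β|) + C) + |s| * (|c| * (|α| + |β|) + C) := fun p y => by
    have hP : ∀ x, ‖shifted c s G p.1.1 (r p.2) x‖ ≤ |s| * (|c| * (|α| + |β|) + C) :=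
      fun x => (hC _ p.1.2 _ (r p.2).2 x).2
    have := isProbabilityMeasure_empMeas hn y
    rw [← integral_empMeas y (hm p)]
    refine (abs_sub _ _).trans (add_le_add ?_ ?_)
    · simpa using norm_integral_le_of_norm_le_const (μ := P) (ae_of_all _ hP)
    · simpa using norm_integral_le_of_norm_le_const (μ := empMeas n y) (ae_of_all _ hP)
  refine integral_mono hint (integrable_ciSup (fun p => ?_) hB _) fun y => ?_
  · exact ((Finset.measurable_fun_sum _ fun j _ =>
      (hm p).comp (measurable_pi_apply j)).const_mul _).const_sub _
  have := isProbabilityMeasure_empMeas hn y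
  have hsup : ∀ ψ ∈ Ψ, ∀ ν ∈ Icc (α - zz f) (β - zz f),
      s * (∫ x, fStarR f a b (ψ x - ν) ∂P - ∫ x, fStarR f a b (ψ x - ν) ∂(empMeas n y)) ≤
      ⨆ p : Ψ × ℕ, (∫ x, shifted c s G p.1.1 (r p.2) x ∂P -
        (n : ℝ)⁻¹ * ∑ j, shifted c s G p.1.1 (r p.2) (y j)) := by
    intro ψ hψ ν hν
    have hcont : Continuous fun ν : Icc (α - zz f) (β - zz f) =>
        ∫ x, shifted c s G ψ ν x ∂P - ∫ x, shifted c s G ψ ν x ∂(empMeas n y) :=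
      (continuous_integral_shifted P hψ (hΨm _ hψ) hbd hG).sub
        (continuous_integral_shifted _ hψ (hΨm _ hψ) hbd hG)
    have hle := (TopologicalSpace.denseRange_denseSeq (Icc (α - zz f) (β - zz f))).induction_on
      (p := fun ν => ∫ x, shifted c s G ψ ν x ∂P - ∫ x, shifted c s G ψ ν x ∂(empMeas n y) ≤
        ⨆ p : Ψ × ℕ, (∫ x, shifted c s G p.1.1 (r p.2) x ∂P -
          (n : ℝ)⁻¹ * ∑ j, shifted c s G p.1.1 (r p.2) (y j)))
      ⟨ν, hν⟩ (isClosed_le hcont continuous_const) fun k => by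
        rw [integral_empMeas y (measurable_shifted (hΨm _ hψ) hG _)]
        exact le_ciSup (bddAbove_range_of_abs_le fun p => hB p y)
          ((⟨ψ, hψ⟩, k) : Ψ × ℕ)
    simp only at hle
    rw [integral_shifted P ha h1 hz hGf' (hΨm _ hψ) (hbd _ hψ) hν,
      integral_shifted _ ha h1 hz hGf' (hΨm _ hψ) (hbd _ hψ) hν] at hle
    linarith
  refine csSup_le ?_ ?_
  · obtain ⟨ψ, hψ⟩ := hne
    exact ⟨_, ψ, hψ, rfl⟩
  rintro _ ⟨ψ, hψ, rfl⟩
  have hsup' := hsup ψ hψ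
  rcases hs with rfl | rfl
  · rw [one_mul]
    exact cgfR_sub_cgfR_le P _ ha h1 hconv hf1 hαβ hz (hΨm _ hψ) (hbd _ hψ) fun ν hν => by
      simpa only [one_mul] using hsup' ν hν
  · rw [neg_one_mul, neg_sub]
    exact cgfR_sub_cgfR_le _ P ha h1 hconv hf1 hαβ hz (hΨm _ hψ) (hbd _ hψ) fun ν hν => by
      simpa only [neg_one_mul, neg_sub] using hsup' ν hν

end UniformDeviation

/-- Uniform law of large numbers for the generalized cumulant
generating function (improved version). -/
theorem stmt7 {Y : Type*} [MeasurableSpace Y]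
    (Ψ : Set (Y → ℝ)) (hΨc : Ψ.Countable)
    (hΨconst : ∃ c : ℝ, (fun _ => c) ∈ Ψ)
    (hΨm : ∀ ψ ∈ Ψ, Measurable ψ) (α β : ℝ) (hbd : ∀ ψ ∈ Ψ, ∀ y, ψ y ∈ Set.Icc α β)
    (f : ℝ → ℝ) (a : ℝ) (b : EReal)
    (ha0 : 0 ≤ a) (ha1 : a < 1) (hb1 : ((1 : ℝ) : EReal) < b)
    (hconv : ConvexOn ℝ (Dom a b) f) (hf1 : f 1 = 0)
    (hstrict : ∃ ε > 0, Set.Ioo (1 - ε) (1 + ε) ⊆ Dom a b ∧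
      StrictConvexOn ℝ (Set.Ioo (1 - ε) (1 + ε)) f)
    (hz : zz f + β - α ∈ interior {z : ℝ | fStar f a b z < ⊤})
    (L : ℝ≥0) (hLip : LipschitzOnWith L (rderiv (fStarR f a b))
      (Set.Icc (zz f - (β - α)) (zz f + (β - α))))
    (P : MeasureTheory.Measure Y) [MeasureTheory.IsProbabilityMeasure P]
    (n : ℕ) (hn : 0 < n) (s : ℝ) (hs : s = 1 ∨ s = -1) :
    (∫ y : Fin n → Y,
        sSup {r : ℝ | ∃ ψ ∈ Ψ, r = s * (cgfR f a b P ψ - cgfR f a b (empMeas n y) ψ)}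
        ∂(MeasureTheory.Measure.pi fun _ : Fin n => P)) ≤
      2 * min ((1 + 2 * (β - α) * (L : ℝ)) * rad Ψ P n
          + (β - α) ^ 2 * (L : ℝ) / (2 * Real.sqrt n))
        (rderiv (fStarR f a b) (β - α + zz f) *
          (rad Ψ P n + (β - α) / (2 * Real.sqrt n))) := by
  have h1 : (1 : ℝ) ∈ Dom a b := ⟨ha1, hb1⟩
  have hne : Ψ.Nonempty := let ⟨_, hk⟩ := hΨconst; ⟨_, hk⟩
  have hαβ : α ≤ β := by
    obtain ⟨k, hk⟩ := hΨconst
    obtain ⟨y⟩ := P.nonempty_of_neZero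
    exact (hbd _ hk y).1.trans (hbd _ hk y).2
  rw [add_sub_assoc] at hz
  have hD := sub_nonneg.2 hαβ
  have hR := rad_nonneg (n := n) hne hbd P
  have hM := rderiv_fStarR_nonneg ha0 h1 hz
  rw [mul_min_of_nonneg _ _ zero_le_two, le_min_iff]
  constructor
  · refine (integral_sSup_cgfR_sub_le (c := 1) (M := NNReal.mk (β - α) hD * L) P ha0 h1 hconv
      hf1 hαβ hz hΨc hne hΨm hbd zero_le_one (LipschitzOnWith.of_dist_le_mul fun x hx y hy => ?_) hn
      hs).trans (mul_le_mul_of_nonneg_left ?_ zero_le_two)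
    · simp only [one_mul]
      exact abs_fStarR_sub_self_sub_le ha0 h1 hconv hf1 hD hz hLip hx hy
    · have h2 : 0 ≤ (β - α) * L * rad Ψ P n := by positivity
      have h3 : (β - α) * L * ((β - α) / (2 * Real.sqrt n)) =
          (β - α) ^ 2 * L / (2 * Real.sqrt n) := by ring
      rw [NNReal.coe_mul, NNReal.coe_mk, h3]
      linarith
  · refine (integral_sSup_cgfR_sub_le (c := 0) (M := NNReal.mk _ hM) P ha0 h1 hconv hf1 hαβ hz
      hΨc hne hΨm hbd le_rfl (LipschitzOnWith.of_dist_le_mul fun x hx y hy => ?_) hn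
      hs).trans (le_of_eq ?_)
    · simp only [zero_mul, sub_zero]
      exact abs_fStarR_sub_le ha0 h1 hz hx.2 hy.2
    · rw [NNReal.coe_mk, add_comm (zz f)]
      ring
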